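/- For every K > 1 and η > 0 there exist L > 0 and θ > 0 with the following property: every piecewise geodesic path γ in ℍⁿ (n ≥ 2), parametrized by arc length, all of whose geodesic subsegments have length at least L and such that at every breakpoint the exterior angle between consecutive segments is at most θ, is a (K, η)-quasi-geodesic; that is, for all parameters s, t one has K⁻¹|s − t| − η ≤ d(γ(s), γ(t)) ≤ |s − t|. Moreover L and θ can be chosen so that K → 1 and η → 0 as L → ∞ and θ → 0. -/

import Mathlib

open Set

noncomputable section

/-- Hyperbolic `(m+1)`-space, in the upper half-space model. -/
def HypSpace (m : ℕ) : Type := {p : Fin (m + 1) → ℝ // 0 < p (Fin.last m)}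

/-- Inverse hyperbolic cosine. -/
def arcosh (x : ℝ) : ℝ := Real.log (x + Real.sqrt (x ^ 2 - 1))

/-- The hyperbolic distance on the upper half-space model of ℍ^(m+1). -/
def hdist {m : ℕ} (p q : HypSpace m) : ℝ :=
  arcosh (1 + (∑ i, (p.1 i - q.1 i) ^ 2) / (2 * p.1 (Fin.last m) * q.1 (Fin.last m)))

/-- The angle at the vertex `B` between the geodesic segments `[B,A]` and `[B,C]`,
defined via the hyperbolic law of cosines. -/
def hAngle {m : ℕ} (A B C : HypSpace m) : ℝ :=
  Real.arccos ((Real.cosh (hdist A B) * Real.cosh (hdist B C) - Real.cosh (hdist A C)) /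
    (Real.sinh (hdist A B) * Real.sinh (hdist B C)))

lemma one_le_hdist_arg {m : ℕ} (p q : HypSpace m) :
    1 ≤ 1 + (∑ i, (p.1 i - q.1 i) ^ 2) / (2 * p.1 (Fin.last m) * q.1 (Fin.last m)) := by
  have hp := p.2
  have hq := q.2
  have : 0 ≤ (∑ i, (p.1 i - q.1 i) ^ 2) / (2 * p.1 (Fin.last m) * q.1 (Fin.last m)) :=
    div_nonneg (Finset.sum_nonneg fun i _ => sq_nonneg _) (by positivity)
  linarith

lemma cosh_hdist {m : ℕ} (p q : HypSpace m) :
    Real.cosh (hdist p q) =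
      1 + (∑ i, (p.1 i - q.1 i) ^ 2) / (2 * p.1 (Fin.last m) * q.1 (Fin.last m)) :=
  Real.cosh_arcosh (one_le_hdist_arg p q)

lemma hdist_nonneg {m : ℕ} (p q : HypSpace m) : 0 ≤ hdist p q :=
  Real.arcosh_nonneg (one_le_hdist_arg p q)

lemma hdist_comm {m : ℕ} (p q : HypSpace m) : hdist p q = hdist q p := by
  have h : ∀ i, (p.1 i - q.1 i) ^ 2 = (q.1 i - p.1 i) ^ 2 := fun i => by ring
  simp only [hdist, h, mul_right_comm]

lemma hdist_self {m : ℕ} (p : HypSpace m) : hdist p p = 0 := by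
  simp [hdist, arcosh]

/-- The spatial part of the hyperboloid coordinates of `p` in the orthonormal frame based at `B`:
a vector pointing from `B` towards `p`, of length `sinh (hdist B p)`. -/
def directionVec {m : ℕ} (B p : HypSpace m) : EuclideanSpace ℝ (Fin (m + 1)) :=
  WithLp.toLp 2 (Fin.snoc (fun i : Fin m => (p.1 i.castSucc - B.1 i.castSucc) / p.1 (Fin.last m))
    ((∑ i : Fin m, (p.1 i.castSucc - B.1 i.castSucc) ^ 2 + p.1 (Fin.last m) ^ 2
      - B.1 (Fin.last m) ^ 2) / (2 * p.1 (Fin.last m) * B.1 (Fin.last m))))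

lemma cosh_hdist_eq_sub_inner {m : ℕ} (B p q : HypSpace m) :
    Real.cosh (hdist p q) = Real.cosh (hdist B p) * Real.cosh (hdist B q)
      - inner ℝ (directionVec B p) (directionVec B q) := by
  rw [cosh_hdist, cosh_hdist, cosh_hdist]
  rcases p with ⟨p, hp⟩
  rcases q with ⟨q, hq⟩
  rcases B with ⟨B, hB⟩
  simp only [directionVec, PiLp.inner_apply, Fin.sum_univ_castSucc, Fin.snoc_castSucc,
    Fin.snoc_last, RCLike.inner_apply, conj_trivial]
  have e1 : ∑ i : Fin m, (p i.castSucc - q i.castSucc) ^ 2 =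
      ∑ i : Fin m, (p i.castSucc - B i.castSucc) ^ 2
      + ∑ i : Fin m, (q i.castSucc - B i.castSucc) ^ 2
      - 2 * ∑ i : Fin m, (p i.castSucc - B i.castSucc) * (q i.castSucc - B i.castSucc) := by
    rw [Finset.mul_sum, ← Finset.sum_add_distrib, ← Finset.sum_sub_distrib]
    exact Finset.sum_congr rfl fun i _ => by ring
  have e2 : ∑ i : Fin m, (q i.castSucc - B i.castSucc) / q (Fin.last m)
        * ((p i.castSucc - B i.castSucc) / p (Fin.last m)) =
      (∑ i : Fin m, (p i.castSucc - B i.castSucc) * (q i.castSucc - B i.castSucc))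
        / (p (Fin.last m) * q (Fin.last m)) := by
    rw [Finset.sum_div]
    exact Finset.sum_congr rfl fun i _ => by field_simp
  have e3 : ∀ r : Fin (m + 1) → ℝ, ∑ i : Fin m, (B i.castSucc - r i.castSucc) ^ 2 =
      ∑ i : Fin m, (r i.castSucc - B i.castSucc) ^ 2 := fun r =>
    Finset.sum_congr rfl fun i _ => by ring
  rw [e1, e2, e3, e3]
  field_simp
  ring

lemma norm_directionVec {m : ℕ} (B p : HypSpace m) :
    ‖directionVec B p‖ = Real.sinh (hdist B p) := by
  rw [← sq_eq_sq₀ (norm_nonneg _) (Real.sinh_nonneg_iff.2 (hdist_nonneg _ _)),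
    ← real_inner_self_eq_norm_sq, Real.sinh_sq]
  have h := cosh_hdist_eq_sub_inner B p p
  rw [hdist_self, Real.cosh_zero] at h
  linarith

lemma hAngle_eq_angle {m : ℕ} (A B C : HypSpace m) :
    hAngle A B C = InnerProductGeometry.angle (directionVec B A) (directionVec B C) := by
  rw [hAngle, InnerProductGeometry.angle, norm_directionVec, norm_directionVec, hdist_comm A B,
    cosh_hdist_eq_sub_inner B A C, sub_sub_cancel]

lemma hAngle_comm {m : ℕ} (A B C : HypSpace m) : hAngle A B C = hAngle C B A := by
  simp only [hAngle_eq_angle, InnerProductGeometry.angle_comm]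

lemma hAngle_le_add {m : ℕ} (A C D B : HypSpace m) :
    hAngle A B D ≤ hAngle A B C + hAngle C B D := by
  simp only [hAngle_eq_angle]
  exact InnerProductGeometry.angle_le_angle_add_angle _ _ _

lemma hyperbolic_law_of_cosines {m : ℕ} (A B C : HypSpace m) :
    Real.cosh (hdist A C) = Real.cosh (hdist A B) * Real.cosh (hdist B C)
      - Real.sinh (hdist A B) * Real.sinh (hdist B C) * Real.cos (hAngle A B C) := by
  rw [hAngle_eq_angle, cosh_hdist_eq_sub_inner B A C, hdist_comm A B, ← norm_directionVec B A,
    ← norm_directionVec B C, ← InnerProductGeometry.cos_angle_mul_norm_mul_norm]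
  ring

lemma sinh_hdist_nonneg {m : ℕ} (p q : HypSpace m) : 0 ≤ Real.sinh (hdist p q) :=
  Real.sinh_nonneg_iff.2 (hdist_nonneg p q)

lemma hdist_triangle {m : ℕ} (A B C : HypSpace m) : hdist A C ≤ hdist A B + hdist B C := by
  have h : Real.cosh (hdist A C) ≤ Real.cosh (hdist A B + hdist B C) := by
    rw [hyperbolic_law_of_cosines A B C, Real.cosh_add]
    nlinarith [mul_nonneg (sinh_hdist_nonneg A B) (sinh_hdist_nonneg B C),
      Real.neg_one_le_cos (hAngle A B C)]
  rwa [Real.cosh_le_cosh, abs_of_nonneg (hdist_nonneg _ _),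
    abs_of_nonneg (add_nonneg (hdist_nonneg _ _) (hdist_nonneg _ _))] at h

/-- A point on a geodesic ray from `B` determines the direction of the ray. -/
lemma hAngle_eq_zero {m : ℕ} {A B C : HypSpace m} (hA : 0 < hdist B A) (hC : 0 < hdist B C)
    (h : hdist A C = |hdist B A - hdist B C|) : hAngle A B C = 0 := by
  have hlaw := hyperbolic_law_of_cosines A B C
  rw [h, Real.cosh_abs, Real.cosh_sub, hdist_comm A B] at hlaw
  have hpos := mul_pos (Real.sinh_pos_iff.2 hA) (Real.sinh_pos_iff.2 hC)
  have hcos : Real.cos (hAngle A B C) = 1 := by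
    apply mul_left_cancel₀ hpos.ne'
    linarith
  rw [hAngle_eq_angle] at hcos ⊢
  rwa [InnerProductGeometry.cos_eq_one_iff_angle_eq_zero] at hcos

lemma hAngle_le_pi {m : ℕ} (A B C : HypSpace m) : hAngle A B C ≤ Real.pi :=
  Real.arccos_le_pi _

/-- If the exterior angle at `B` is small, passing through `B` is almost shortest. -/
lemma hdist_add_sub_le_of_exterior_angle_le {m : ℕ} {A B C : HypSpace m} {α δ : ℝ}
    (hα : α ≤ Real.pi / 2) (hδ : 0 ≤ δ) (hcos : 1 ≤ Real.cos α * Real.cosh δ)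
    (hang : Real.pi - α ≤ hAngle A B C) : hdist A B + hdist B C - δ ≤ hdist A C := by
  have hle : Real.cos (hAngle A B C) ≤ -Real.cos α := by
    rw [← Real.cos_pi_sub]
    exact Real.cos_le_cos_of_nonneg_of_le_pi (by linarith [Real.pi_pos]) (hAngle_le_pi _ _ _) hang
  have hS := mul_nonneg (sinh_hdist_nonneg A B) (sinh_hdist_nonneg B C)
  have h1 : Real.cos α * Real.cosh (hdist A B + hdist B C) ≤ Real.cosh (hdist A C) := by
    rw [hyperbolic_law_of_cosines A B C, Real.cosh_add]
    nlinarith [mul_le_mul_of_nonneg_left hle hS, Real.cos_le_one α,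
      mul_pos (Real.cosh_pos (hdist A B)) (Real.cosh_pos (hdist B C))]
  have h2 : Real.cosh (hdist A B + hdist B C) ≤ Real.cosh (hdist A C + δ) := by
    calc Real.cosh (hdist A B + hdist B C)
        ≤ Real.cos α * Real.cosh δ * Real.cosh (hdist A B + hdist B C) :=
          le_mul_of_one_le_left (Real.cosh_pos _).le hcos
      _ = Real.cosh δ * (Real.cos α * Real.cosh (hdist A B + hdist B C)) := by ring
      _ ≤ Real.cosh δ * Real.cosh (hdist A C) :=
          mul_le_mul_of_nonneg_left h1 (Real.cosh_pos _).le
      _ ≤ Real.cosh (hdist A C + δ) := by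
          rw [Real.cosh_add]
          nlinarith [mul_nonneg (sinh_hdist_nonneg A C) (Real.sinh_nonneg_iff.2 hδ)]
  rw [Real.cosh_le_cosh, abs_of_nonneg (add_nonneg (hdist_nonneg _ _) (hdist_nonneg _ _)),
    abs_of_nonneg (add_nonneg (hdist_nonneg _ _) hδ)] at h2
  linarith

/-- In a triangle with an obtuse angle at `B` and long side `BC`, the angle at `C` is small. -/
lemma hAngle_le_of_obtuse {m : ℕ} {A B C : HypSpace m} {θ : ℝ} (hθ0 : 0 ≤ θ)
    (hθ : θ ≤ Real.pi / 2) (hobt : Real.pi / 2 ≤ hAngle A B C) (hBC : 0 < hdist B C)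
    (hlong : Real.cos θ * Real.cosh (hdist B C) ≤ Real.sinh (hdist B C)) :
    hAngle A C B ≤ θ := by
  have hB := hyperbolic_law_of_cosines A B C
  have hC := hyperbolic_law_of_cosines A C B
  rw [hdist_comm C B] at hC
  have hcosB : Real.cos (hAngle A B C) ≤ 0 := Real.cos_nonpos_of_pi_div_two_le_of_le hobt
    (by linarith [hAngle_le_pi A B C, Real.pi_pos])
  have hcosθ : 0 ≤ Real.cos θ := Real.cos_nonneg_of_neg_pi_div_two_le_of_le (by linarith) hθ
  have hS := mul_nonneg (sinh_hdist_nonneg A B) (sinh_hdist_nonneg B C)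
  have hsa := sinh_hdist_nonneg A C
  have hsb : 0 < Real.sinh (hdist B C) := Real.sinh_pos_iff.2 hBC
  have hca := Real.cosh_pos (hdist A C)
  have hcb := Real.cosh_pos (hdist B C)
  have hge : Real.cosh (hdist A B) * Real.cosh (hdist B C) ≤ Real.cosh (hdist A C) := by
    nlinarith
  have hAC : 0 < hdist A C := by
    refine lt_of_lt_of_le hBC ?_
    have h : Real.cosh (hdist B C) ≤ Real.cosh (hdist A C) := by
      nlinarith [Real.one_le_cosh (hdist A B)]
    rwa [Real.cosh_le_cosh, abs_of_nonneg (hdist_nonneg _ _),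
      abs_of_nonneg (hdist_nonneg _ _)] at h
  have hsa : 0 < Real.sinh (hdist A C) := Real.sinh_pos_iff.2 hAC
  have h1 : Real.cosh (hdist A C) * Real.sinh (hdist B C) ≤
      Real.sinh (hdist A C) * Real.cos (hAngle A C B) * Real.cosh (hdist B C) := by
    refine le_of_mul_le_mul_left ?_ hsb
    have hsq := Real.cosh_sq (hdist B C)
    nlinarith
  have h2 : Real.cosh (hdist A C) * Real.cos θ ≤
      Real.sinh (hdist A C) * Real.cos (hAngle A C B) := by
    refine le_of_mul_le_mul_right ?_ hcb
    nlinarith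
  have h3 : Real.cos θ ≤ Real.cos (hAngle A C B) := by
    refine le_of_mul_le_mul_left ?_ hsa
    nlinarith [Real.sinh_lt_cosh (hdist A C)]
  by_contra! hlt
  exact absurd (Real.cos_lt_cos_of_nonneg_of_le_pi hθ0 (hAngle_le_pi _ _ _) hlt) (not_lt.2 h3)

lemma exists_mem_Ico_of_monotone_partition {T : ℕ → ℝ} {k : ℕ} {s : ℝ} (h0 : T 0 ≤ s)
    (hk : s < T k) : ∃ j < k, s ∈ Ico (T j) (T (j + 1)) := by
  induction k with
  | zero => exact absurd hk (not_lt.2 h0)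
  | succ k ih =>
    rcases lt_or_ge s (T k) with h | h
    · obtain ⟨j, hj, hs⟩ := ih h
      exact ⟨j, by omega, hs⟩
    · exact ⟨k, by omega, h, hk⟩

/-- Constants `L` and `θ` for which the additive loss at each breakpoint is at most `η`, and the
loss is also at most the fraction `1 - K⁻¹` of the length of a segment. -/
lemma exists_length_angle_constants {K η : ℝ} (hK : 1 < K) (hη : 0 < η) :
    ∃ L : ℝ, 0 < L ∧ ∃ θ : ℝ, 0 < θ ∧ 2 * θ ≤ Real.pi / 2 ∧
      1 ≤ Real.cos (2 * θ) * Real.cosh η ∧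
      ∀ b, L ≤ b → Real.cos θ * Real.cosh b ≤ Real.sinh b ∧ K⁻¹ * b ≤ b - η := by
  have hch : 1 < Real.cosh η := Real.one_lt_cosh.2 hη.ne'
  have hinv : (Real.cosh η)⁻¹ < 1 := inv_lt_one_of_one_lt₀ hch
  have hinv0 : 0 < (Real.cosh η)⁻¹ := by positivity
  set θ := Real.arccos (Real.cosh η)⁻¹ / 2 with hθdef
  have h2θ : 2 * θ = Real.arccos (Real.cosh η)⁻¹ := by rw [hθdef]; ring
  have hθ : 0 < θ := by have := Real.arccos_pos.2 hinv; linarith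
  have hθ2 : 2 * θ ≤ Real.pi / 2 := h2θ ▸ Real.arccos_le_pi_div_two.2 hinv0.le
  have hcosθ0 : 0 < Real.cos θ := Real.cos_pos_of_mem_Ioo ⟨by linarith, by linarith⟩
  have hcosθ1 : Real.cos θ < 1 := by
    have := Real.cos_lt_cos_of_nonneg_of_le_pi le_rfl (by linarith) hθ
    rwa [Real.cos_zero] at this
  have hK1 : 0 < 1 - K⁻¹ := sub_pos.2 (inv_lt_one_of_one_lt₀ hK)
  refine ⟨max (η / (1 - K⁻¹)) (Real.artanh (Real.cos θ)),
    lt_max_of_lt_left (div_pos hη hK1), θ, hθ, hθ2, ?_, fun b hb => ⟨?_, ?_⟩⟩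
  · rw [h2θ, Real.cos_arccos (by linarith) hinv.le, inv_mul_cancel₀ (by positivity)]
  · have h := Real.sinh_nonneg_iff.2 (sub_nonneg.2 ((le_max_right _ _).trans hb))
    have ht := Real.tanh_artanh (x := Real.cos θ) ⟨by linarith, hcosθ1⟩
    have hc := Real.cosh_pos (Real.artanh (Real.cos θ))
    rw [Real.tanh_eq_sinh_div_cosh, div_eq_iff hc.ne'] at ht
    rw [Real.sinh_sub, ht] at h
    refine le_of_mul_le_mul_right ?_ hc
    linarith
  · have h := (le_max_left _ _).trans hb
    rw [div_le_iff₀ hK1] at h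
    linarith

section PiecewiseGeodesic

variable {m k : ℕ} {γ : ℝ → HypSpace m} {T : ℕ → ℝ} {K η L θ : ℝ}

lemma breakpoint_le_breakpoint (hT : ∀ i < k, T i < T (i + 1)) {i j : ℕ} (hij : i ≤ j)
    (hj : j ≤ k) : T i ≤ T j := by
  induction j, hij using Nat.le_induction with
  | base => rfl
  | succ j _ ih => exact (ih (by omega)).trans (hT j (by omega)).le

/-- Seen from a point in segment `j`, the path keeps exterior angle at most `2 * θ` at every later
breakpoint, and recedes at linear rate. -/
lemma piecewise_geodesic_breakpoint_bounds (hK : 1 < K) (hη : 0 < η) (hθ : 0 < θ)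
    (hθ2 : 2 * θ ≤ Real.pi / 2) (hcos : 1 ≤ Real.cos (2 * θ) * Real.cosh η)
    (hlong : ∀ b, L ≤ b → Real.cos θ * Real.cosh b ≤ Real.sinh b ∧ K⁻¹ * b ≤ b - η)
    (hT : ∀ i < k, T i < T (i + 1) ∧ L ≤ T (i + 1) - T i)
    (hgeo : ∀ i < k, ∀ s ∈ Icc (T i) (T (i + 1)), ∀ t ∈ Icc (T i) (T (i + 1)),
      hdist (γ s) (γ t) = |s - t|)
    (hang : ∀ i, 0 < i → i < k →
      Real.pi - hAngle (γ (T (i - 1))) (γ (T i)) (γ (T (i + 1))) ≤ θ)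
    {j : ℕ} {s : ℝ} (hs : s ∈ Ico (T j) (T (j + 1))) {i : ℕ} (hji : j + 1 ≤ i) (hi : i < k) :
    Real.pi - 2 * θ ≤ hAngle (γ s) (γ (T i)) (γ (T (i + 1))) ∧
      K⁻¹ * (T i - s) ≤ hdist (γ s) (γ (T i)) ∧ hdist (γ s) (γ (T i)) ≤ T i - s := by
  have hK1 : K⁻¹ < 1 := inv_lt_one_of_one_lt₀ hK
  induction i, hji using Nat.le_induction with
  | base =>
    have hj : j < k := by omega
    have hTj := (hT j hj).1
    have hd : ∀ u ∈ Ico (T j) (T (j + 1)), hdist (γ (T (j + 1))) (γ u) = T (j + 1) - u := by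
      intro u hu
      rw [hgeo j hj _ ⟨hTj.le, le_rfl⟩ _ (Ico_subset_Icc_self hu),
        abs_of_pos (sub_pos.2 hu.2)]
    have hds := hd s hs
    have hdj := hd (T j) ⟨le_rfl, hTj⟩
    have hzero : hAngle (γ (T j)) (γ (T (j + 1))) (γ s) = 0 := by
      refine hAngle_eq_zero (by linarith) (by linarith [hs.2]) ?_
      rw [hdj, hds, hgeo j hj _ ⟨le_rfl, hTj.le⟩ _ (Ico_subset_Icc_self hs), abs_sub_comm]
      congr 1
      ring
    have h1 := hang (j + 1) (by omega) hi
    rw [Nat.add_sub_cancel] at h1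
    have h2 := hAngle_le_add (γ (T j)) (γ s) (γ (T (j + 1 + 1))) (γ (T (j + 1)))
    rw [hdist_comm, hds]
    refine ⟨by linarith, ?_, le_rfl⟩
    nlinarith [hs.2]
  | succ i hji ih =>
    have hik : i < k := by omega
    obtain ⟨hA, hlow, hup⟩ := ih hik
    obtain ⟨hTi, hLi⟩ := hT i hik
    have hd : hdist (γ (T i)) (γ (T (i + 1))) = T (i + 1) - T i := by
      rw [hgeo i hik _ ⟨le_rfl, hTi.le⟩ _ ⟨hTi.le, le_rfl⟩, abs_sub_comm,
        abs_of_pos (sub_pos.2 hTi)]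
    obtain ⟨hb1, hb2⟩ := hlong _ hLi
    have hsmall : hAngle (γ s) (γ (T (i + 1))) (γ (T i)) ≤ θ :=
      hAngle_le_of_obtuse hθ.le (by linarith) (by linarith) (by linarith) (by rwa [hd])
    have h1 := hang (i + 1) (by omega) hi
    rw [Nat.add_sub_cancel] at h1
    have h2 := hAngle_le_add (γ (T i)) (γ s) (γ (T (i + 1 + 1))) (γ (T (i + 1)))
    rw [hAngle_comm] at hsmall
    have h3 := hdist_add_sub_le_of_exterior_angle_le hθ2 hη.le hcos hA
    have h4 := hdist_triangle (γ s) (γ (T i)) (γ (T (i + 1)))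
    exact ⟨by linarith, by linarith, by linarith⟩

lemma piecewise_geodesic_bounds_of_lt (hK : 1 < K) (hη : 0 < η) (hθ : 0 < θ)
    (hθ2 : 2 * θ ≤ Real.pi / 2) (hcos : 1 ≤ Real.cos (2 * θ) * Real.cosh η)
    (hlong : ∀ b, L ≤ b → Real.cos θ * Real.cosh b ≤ Real.sinh b ∧ K⁻¹ * b ≤ b - η)
    (hT : ∀ i < k, T i < T (i + 1) ∧ L ≤ T (i + 1) - T i)
    (hgeo : ∀ i < k, ∀ s ∈ Icc (T i) (T (i + 1)), ∀ t ∈ Icc (T i) (T (i + 1)),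
      hdist (γ s) (γ t) = |s - t|)
    (hang : ∀ i, 0 < i → i < k →
      Real.pi - hAngle (γ (T (i - 1))) (γ (T i)) (γ (T (i + 1))) ≤ θ)
    {s t : ℝ} (h0s : T 0 ≤ s) (hst : s < t) (htk : t ≤ T k) :
    K⁻¹ * (t - s) - η ≤ hdist (γ s) (γ t) ∧ hdist (γ s) (γ t) ≤ t - s := by
  have hK1 : K⁻¹ < 1 := inv_lt_one_of_one_lt₀ hK
  obtain ⟨j, hj, hs⟩ := exists_mem_Ico_of_monotone_partition h0s (hst.trans_le htk)
  rcases le_or_gt t (T (j + 1)) with ht | ht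
  · rw [hgeo j hj s (Ico_subset_Icc_self hs) t ⟨hs.1.trans hst.le, ht⟩, abs_sub_comm,
      abs_of_pos (sub_pos.2 hst)]
    exact ⟨by nlinarith, le_rfl⟩
  obtain ⟨i, hi, hit, hti⟩ : ∃ i < k, T i < t ∧ t ≤ T (i + 1) := by
    rcases htk.lt_or_eq with h | rfl
    · obtain ⟨i, hi, h1, h2⟩ := exists_mem_Ico_of_monotone_partition (h0s.trans hst.le) h
      rcases h1.lt_or_eq with h1 | rfl
      · exact ⟨i, hi, h1, h2.le⟩
      · obtain _ | i := i
        · exact absurd hst (not_lt.2 h0s)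
        · exact ⟨i, by omega, (hT i (by omega)).1, le_rfl⟩
    · obtain ⟨n, rfl⟩ : ∃ n, k = n + 1 := ⟨k - 1, by omega⟩
      exact ⟨n, by omega, (hT n (by omega)).1, le_rfl⟩
  have hji : j + 1 ≤ i := by
    by_contra! h
    exact absurd (hti.trans (breakpoint_le_breakpoint (fun i hi => (hT i hi).1)
      (by omega : i + 1 ≤ j + 1) hj)) (not_le.2 ht)
  obtain ⟨hA, hlow, hup⟩ := piecewise_geodesic_breakpoint_bounds hK hη hθ hθ2 hcos hlong hT
    hgeo hang hs hji hi
  have hTi := (hT i hi).1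
  have hdt : hdist (γ (T i)) (γ t) = t - T i := by
    rw [hgeo i hi _ ⟨le_rfl, hTi.le⟩ _ ⟨hit.le, hti⟩, abs_sub_comm, abs_of_pos (sub_pos.2 hit)]
  have hdi : hdist (γ (T i)) (γ (T (i + 1))) = T (i + 1) - T i := by
    rw [hgeo i hi _ ⟨le_rfl, hTi.le⟩ _ ⟨hTi.le, le_rfl⟩, abs_sub_comm,
      abs_of_pos (sub_pos.2 hTi)]
  have hzero : hAngle (γ t) (γ (T i)) (γ (T (i + 1))) = 0 := by
    refine hAngle_eq_zero (by linarith) (by linarith) ?_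
    rw [hdt, hdi, hgeo i hi _ ⟨hit.le, hti⟩ _ ⟨hTi.le, le_rfl⟩]
    congr 1
    ring
  have h1 := hAngle_le_add (γ s) (γ t) (γ (T (i + 1))) (γ (T i))
  have h2 := hdist_add_sub_le_of_exterior_angle_le (C := γ t) hθ2 hη.le hcos
    (by linarith : Real.pi - 2 * θ ≤ hAngle (γ s) (γ (T i)) (γ t))
  have h3 := hdist_triangle (γ s) (γ (T i)) (γ t)
  exact ⟨by nlinarith, by linarith⟩

end PiecewiseGeodesic

/-- for all `K > 1`, `η > 0` there are `L > 0`, `θ > 0` such that every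
piecewise geodesic in ℍⁿ (`n = m+1 ≥ 2`), parametrized by arc length, whose geodesic
pieces have length at least `L` and whose exterior angles at the breakpoints are at
most `θ`, is a `(K, η)`-quasi-geodesic. -/
theorem piecewise_geodesic_quasi_geodesic :
    ∀ K : ℝ, 1 < K → ∀ η : ℝ, 0 < η →
    ∃ L : ℝ, 0 < L ∧ ∃ θ : ℝ, 0 < θ ∧
    ∀ m : ℕ, 1 ≤ m → ∀ (γ : ℝ → HypSpace m) (k : ℕ) (T : ℕ → ℝ), 0 < k →
      (∀ i < k, T i < T (i + 1) ∧ L ≤ T (i + 1) - T i) →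
      (∀ i < k, ∀ s ∈ Icc (T i) (T (i + 1)), ∀ t ∈ Icc (T i) (T (i + 1)),
        hdist (γ s) (γ t) = |s - t|) →
      (∀ i, 0 < i → i < k →
        Real.pi - hAngle (γ (T (i - 1))) (γ (T i)) (γ (T (i + 1))) ≤ θ) →
      ∀ s ∈ Icc (T 0) (T k), ∀ t ∈ Icc (T 0) (T k),
        K⁻¹ * |s - t| - η ≤ hdist (γ s) (γ t) ∧ hdist (γ s) (γ t) ≤ |s - t| := by
  intro K hK η hη
  obtain ⟨L, hL, θ, hθ, hθ2, hcos, hlong⟩ := exists_length_angle_constants hK hη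
  refine ⟨L, hL, θ, hθ, fun m _ γ k T _ hT hgeo hang s hs t ht => ?_⟩
  have key := fun {u v : ℝ} => piecewise_geodesic_bounds_of_lt (s := u) (t := v) hK hη hθ hθ2
    hcos hlong hT hgeo hang
  rcases lt_trichotomy s t with h | rfl | h
  · rw [abs_sub_comm, abs_of_pos (sub_pos.2 h)]
    exact key hs.1 h ht.2
  · simp [hdist_self, hη.le]
  · rw [hdist_comm, abs_of_pos (sub_pos.2 h)]
    exact key ht.1 h hs.2

end
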